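/- arXiv:1409.5716 — 7 statements merged into one kernel-verified Lean document; each statement's English description precedes it below -/
import Mathlib

section
/- Fix a transmit power q > 0, channel gains |g|² > 0, noise variance σ² > 0, and interference power P := p|h|² > 0. Then the primary-user rate R_PU(q,κ) := log₂(1 + P/(σ² + q|g|²)) + (1/2)·log₂((1 − κ_y²)/(1 − κ_in²)), with κ_y := κ/(1 + (P+σ²)/(q|g|²)) and κ_in := κ/(1 + σ²/(q|g|²)), is a strictly increasing function of the circularity coefficient κ on [0,1]: for 0 ≤ κ₁ < κ₂ ≤ 1, R_PU(q,κ₁) < R_PU(q,κ₂). -/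
/-- For `1 < B < A`, the ratio `(1 - (x / A)²) / (1 - (x / B)²)` is positive and strictly
increasing in `x` on `[0, 1]`. -/
theorem one_sub_div_sq_ratio_lt {A B x y : ℝ} (hB : 1 < B) (hBA : B < A)
    (hx : 0 ≤ x) (hxy : x < y) (hy : y ≤ 1) :
    0 < (1 - (x / A) ^ 2) / (1 - (x / B) ^ 2) ∧
      (1 - (x / A) ^ 2) / (1 - (x / B) ^ 2) < (1 - (y / A) ^ 2) / (1 - (y / B) ^ 2) := by
  have one_sub_pos {C t : ℝ} (hC : 1 < C) (ht : 0 ≤ t) (ht1 : t ≤ 1) :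
      0 < 1 - (t / C) ^ 2 := by
    have hlt : t / C < 1 := (div_lt_one (by linarith)).2 (by linarith)
    have hnonneg : 0 ≤ t / C := by positivity
    nlinarith
  have hxB := one_sub_pos hB hx (hxy.le.trans hy)
  have hyB := one_sub_pos hB (hx.trans hxy.le) hy
  refine ⟨div_pos (one_sub_pos (hB.trans hBA) hx (hxy.le.trans hy)) hxB, ?_⟩
  rw [div_lt_div_iff₀ hxB hyB]
  have hA : 0 < A := by linarith
  have hinv : A⁻¹ ^ 2 < B⁻¹ ^ 2 := by gcongr
  have hsq : x ^ 2 < y ^ 2 := by gcongr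
  simp only [div_eq_mul_inv]
  linarith [mul_pos (sub_pos.2 hinv) (sub_pos.2 hsq)]

/-- For fixed transmit power `q > 0`, the primary-user rate
`R_PU(q,κ)` is strictly increasing in the circularity coefficient `κ` on `[0,1]`.
Here `g2 = |g|²`, `P = p|h|²`, `σ2 = σ²`. -/
theorem pu_rate_strictMono_in_kappa
    (q g2 σ2 P : ℝ)
    (hq : 0 < q) (hg : 0 < g2) (hσ : 0 < σ2) (hP : 0 < P)
    (RPU : ℝ → ℝ)
    (hR : ∀ κ : ℝ, RPU κ = Real.logb 2 (1 + P / (σ2 + q * g2))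
        + (1 / 2) * Real.logb 2
            ((1 - (κ / (1 + (P + σ2) / (q * g2))) ^ 2)
              / (1 - (κ / (1 + σ2 / (q * g2))) ^ 2))) :
    ∀ κ₁ κ₂ : ℝ, 0 ≤ κ₁ → κ₁ < κ₂ → κ₂ ≤ 1 → RPU κ₁ < RPU κ₂ := by
  intro κ₁ κ₂ h0 h12 h1
  have hqg : 0 < q * g2 := mul_pos hq hg
  have hB : 1 < 1 + σ2 / (q * g2) := lt_add_of_pos_right 1 (by positivity)
  have hBA : 1 + σ2 / (q * g2) < 1 + (P + σ2) / (q * g2) := by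
    gcongr
    linarith
  obtain ⟨hpos, hlt⟩ := one_sub_div_sq_ratio_lt hB hBA h0 h12 h1
  rw [hR, hR]
  have := Real.logb_lt_logb one_lt_two hpos hlt
  linarith
end

section
/- Let R₀ > 0 and α ∈ (0,1]. Define γ(a) := 2^{a·R₀} − 1, β := 1 − γ(1)/γ(2α), and C := γ(2)/γ(2α) − 1. Then √(β² + C) − β = γ(1)/γ(α) − 1. Consequently, the allowed-power function q(κ) := (√(β² + (1−κ²)·C) − β)·σ²/(|g|²·(1−κ²)) of the improper case evaluated at κ = 0 coincides with the proper-case allowed power (σ²/|g|²)·(γ(1)/γ(α) − 1). -/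
theorem sqrt_sub_eq_of_one_lt {x y : ℝ} (hx : 1 < x) (hy : 1 < y) :
    Real.sqrt ((1 - (x - 1) / (y ^ 2 - 1)) ^ 2 + ((x ^ 2 - 1) / (y ^ 2 - 1) - 1))
      - (1 - (x - 1) / (y ^ 2 - 1)) = (x - 1) / (y - 1) - 1 := by
  have hy1 : 0 < y - 1 := by linarith
  have hy2 : 0 < y + 1 := by linarith
  have hx1 : 0 < x - 1 := by linarith
  have hy0 : 0 < y := by linarith
  rw [show y ^ 2 - 1 = (y - 1) * (y + 1) by ring]
  have hsq : (1 - (x - 1) / ((y - 1) * (y + 1))) ^ 2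
      + ((x ^ 2 - 1) / ((y - 1) * (y + 1)) - 1)
      = (y * (x - 1) / ((y - 1) * (y + 1))) ^ 2 := by
    field_simp
    ring
  rw [hsq, Real.sqrt_sq (by positivity)]
  field_simp
  ring


/-- With `β = 1 − γ(1)/γ(2α)` and `C = γ(2)/γ(2α) − 1`,
one has `√(β² + C) − β = γ(1)/γ(α) − 1`; consequently the improper-case
allowed-power function evaluated at `κ = 0` coincides with the proper-case
allowed power `(σ²/|g|²)(γ(1)/γ(α) − 1)`. Here `g2 = |g|²`, `σ2 = σ²`. -/
theorem improper_power_at_zero_matches_proper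
    (R0 α : ℝ) (hR0 : 0 < R0) (hα0 : 0 < α) (hα1 : α ≤ 1)
    (γ : ℝ → ℝ) (hγ : ∀ a : ℝ, γ a = (2 : ℝ) ^ (a * R0) - 1)
    (β C : ℝ)
    (hβ : β = 1 - γ 1 / γ (2 * α)) (hC : C = γ 2 / γ (2 * α) - 1) :
    Real.sqrt (β ^ 2 + C) - β = γ 1 / γ α - 1 ∧
      ∀ σ2 g2 : ℝ, 0 < σ2 → 0 < g2 →
        (Real.sqrt (β ^ 2 + (1 - (0 : ℝ) ^ 2) * C) - β) * σ2
            / (g2 * (1 - (0 : ℝ) ^ 2))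
          = (σ2 / g2) * (γ 1 / γ α - 1) := by
  have hx : 1 < (2 : ℝ) ^ R0 := Real.one_lt_rpow one_lt_two hR0
  have hy : 1 < (2 : ℝ) ^ (α * R0) := Real.one_lt_rpow one_lt_two (mul_pos hα0 hR0)
  have h2 : (2 : ℝ) ^ (2 * R0) = ((2 : ℝ) ^ R0) ^ 2 := by
    rw [mul_comm, Real.rpow_mul zero_le_two, Real.rpow_two]
  have h2α : (2 : ℝ) ^ (2 * α * R0) = ((2 : ℝ) ^ (α * R0)) ^ 2 := by
    rw [mul_assoc, mul_comm, Real.rpow_mul zero_le_two, Real.rpow_two]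
  have key : Real.sqrt (β ^ 2 + C) - β = γ 1 / γ α - 1 := by
    rw [hβ, hC, hγ 1, hγ 2, hγ α, hγ (2 * α), one_mul, h2, h2α]
    exact sqrt_sub_eq_of_one_lt hx hy
  refine ⟨key, fun σ2 g2 _ _ => ?_⟩
  rw [← key]
  norm_num
  ring
end

section
/- Let σ² > 0, |g|² > 0, β ∈ ℝ, and C > 0, and for κ ∈ [0,1) define q(κ) := (√(β² + (1−κ²)·C) − β)·σ²/(|g|²·(1−κ²)). Then q is strictly increasing on [0,1): for 0 ≤ κ₁ < κ₂ < 1, q(κ₁) < q(κ₂). -/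
theorem sqrt_sq_add_add_pos (β : ℝ) {x : ℝ} (hx : 0 < x) :
    0 < Real.sqrt (β ^ 2 + x) + β := by
  have h : |β| < Real.sqrt (β ^ 2 + x) := Real.lt_sqrt_of_sq_lt (by rw [sq_abs]; linarith)
  linarith [neg_abs_le β]

/-- Rationalizing the numerator of the allowed power. -/
theorem sqrt_sq_add_sub_mul_div_eq {σ2 g2 β C t : ℝ} (hg : g2 ≠ 0) (hC : 0 < C) (ht : 0 < t) :
    (Real.sqrt (β ^ 2 + t * C) - β) * σ2 / (g2 * t)
      = C * σ2 / (g2 * (Real.sqrt (β ^ 2 + t * C) + β)) := by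
  have hpos := sqrt_sq_add_add_pos β (mul_pos ht hC)
  have hsq : Real.sqrt (β ^ 2 + t * C) ^ 2 = β ^ 2 + t * C := Real.sq_sqrt (by positivity)
  rw [div_eq_div_iff (by positivity) (by positivity)]
  linear_combination σ2 * g2 * hsq

/-- The allowed-power function
`q(κ) = (√(β² + (1−κ²)C) − β)·σ²/(|g|²(1−κ²))` is strictly increasing
on `[0,1)`. Here `g2 = |g|²`, `σ2 = σ²`. -/
theorem allowed_power_strictMono
    (σ2 g2 β C : ℝ)
    (hσ : 0 < σ2) (hg : 0 < g2) (hC : 0 < C)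
    (q : ℝ → ℝ)
    (hq : ∀ κ : ℝ, q κ = (Real.sqrt (β ^ 2 + (1 - κ ^ 2) * C) - β) * σ2
        / (g2 * (1 - κ ^ 2))) :
    ∀ κ₁ κ₂ : ℝ, 0 ≤ κ₁ → κ₁ < κ₂ → κ₂ < 1 → q κ₁ < q κ₂ := by
  intro κ₁ κ₂ h₀ h₁₂ h₂
  have hκ : κ₁ ^ 2 < κ₂ ^ 2 := by gcongr
  have ht₂ : 0 < 1 - κ₂ ^ 2 := by nlinarith
  have ht₁ : 0 < 1 - κ₁ ^ 2 := by linarith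
  rw [hq, hq, sqrt_sq_add_sub_mul_div_eq hg.ne' hC ht₁, sqrt_sq_add_sub_mul_div_eq hg.ne' hC ht₂]
  have hpos := sqrt_sq_add_add_pos β (mul_pos ht₂ hC)
  gcongr
end

section
/- Let σ² > 0, σ̃² > 0, |g|² > 0, |f|² > 0, β ∈ ℝ, C > 0, and for κ ∈ [0,1) define q(κ) := (√(β² + (1−κ²)·C) − β)·σ²/(|g|²·(1−κ²)) and T(κ) := (2·q(κ)·|f|²/σ̃²)·(1 − β·|f|²·σ²/(|g|²·σ̃²)) + (|f|⁴·σ⁴/(|g|⁴·σ̃⁴))·C + 1. If |g|²·σ̃²/(|f|²·σ²) > β, then the secondary-user rate R_SU(κ) := (1/2)·log₂(T(κ)) is strictly increasing on [0,1): for 0 ≤ κ₁ < κ₂ < 1, R_SU(κ₁) < R_SU(κ₂). -/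
/-- For `x, C > 0`, the square root `√(β² + xC)` exceeds `|β|`. -/
lemma abs_lt_sqrt_sq_add_mul {β C x : ℝ} (hC : 0 < C) (hx : 0 < x) :
    |β| < √(β ^ 2 + x * C) := by
  rw [← Real.sqrt_sq_eq_abs]
  exact Real.sqrt_lt_sqrt (sq_nonneg β) (lt_add_of_pos_right _ (mul_pos hx hC))

/-- Rationalized form of `(√(β² + xC) - β) / x`. -/
lemma sqrt_sq_add_mul_sub_div {β C x : ℝ} (hC : 0 < C) (hx : 0 < x) :
    (√(β ^ 2 + x * C) - β) / x = C / (√(β ^ 2 + x * C) + β) := by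
  have hs := (abs_lt.mp (abs_lt_sqrt_sq_add_mul (β := β) hC hx)).1
  have hsq : √(β ^ 2 + x * C) ^ 2 = β ^ 2 + x * C := Real.sq_sqrt (by positivity)
  rw [div_eq_div_iff hx.ne' (by linarith)]
  linear_combination hsq

lemma sqrt_sq_add_mul_sub_div_pos {β C x : ℝ} (hC : 0 < C) (hx : 0 < x) :
    0 < (√(β ^ 2 + x * C) - β) / x :=
  div_pos (sub_pos.mpr (abs_lt.mp (abs_lt_sqrt_sq_add_mul hC hx)).2) hx

/-- The map `x ↦ (√(β² + xC) - β) / x` is strictly decreasing on `(0, ∞)`. -/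
lemma strictAntiOn_sqrt_sq_add_mul_sub_div {β C : ℝ} (hC : 0 < C) :
    StrictAntiOn (fun x => (√(β ^ 2 + x * C) - β) / x) (Set.Ioi 0) := by
  intro x (hx : 0 < x) y (hy : 0 < y) hxy
  have hs := (abs_lt.mp (abs_lt_sqrt_sq_add_mul (β := β) hC hx)).1
  have hlt : √(β ^ 2 + x * C) < √(β ^ 2 + y * C) :=
    Real.sqrt_lt_sqrt (by positivity) (by gcongr)
  simp only [sqrt_sq_add_mul_sub_div hC hx, sqrt_sq_add_mul_sub_div hC hy]
  exact div_lt_div_of_pos_left hC (by linarith) (by linarith)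

/-- Forward direction of Theorem 1. If
`|g|²σ̃²/(|f|²σ²) > β`, then the secondary-user rate
`R_SU(κ) = (1/2)·log₂(T(κ))` is strictly increasing on `[0,1)`.
Here `g2 = |g|²`, `f2 = |f|²`, `σ2 = σ²`, `σt2 = σ̃²`. -/
theorem su_rate_strictMono_of_condition
    (σ2 σt2 g2 f2 β C : ℝ)
    (hσ : 0 < σ2) (hσt : 0 < σt2) (hg : 0 < g2) (hf : 0 < f2) (hC : 0 < C)
    (q T RSU : ℝ → ℝ)
    (hq : ∀ κ : ℝ, q κ = (Real.sqrt (β ^ 2 + (1 - κ ^ 2) * C) - β) * σ2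
        / (g2 * (1 - κ ^ 2)))
    (hT : ∀ κ : ℝ, T κ = (2 * q κ * f2 / σt2) * (1 - β * f2 * σ2 / (g2 * σt2))
        + (f2 ^ 2 * σ2 ^ 2 / (g2 ^ 2 * σt2 ^ 2)) * C + 1)
    (hRSU : ∀ κ : ℝ, RSU κ = (1 / 2) * Real.logb 2 (T κ))
    (hcond : g2 * σt2 / (f2 * σ2) > β) :
    ∀ κ₁ κ₂ : ℝ, 0 ≤ κ₁ → κ₁ < κ₂ → κ₂ < 1 → RSU κ₁ < RSU κ₂ := by
  intro κ₁ κ₂ h₁ h₁₂ h₂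
  have hx₂ : 0 < 1 - κ₂ ^ 2 := by nlinarith
  have hx₁₂ : 1 - κ₂ ^ 2 < 1 - κ₁ ^ 2 := by nlinarith
  have hx₁ : 0 < 1 - κ₁ ^ 2 := hx₂.trans hx₁₂
  have hq' (κ : ℝ) : q κ = (√(β ^ 2 + (1 - κ ^ 2) * C) - β) / (1 - κ ^ 2) * (σ2 / g2) := by
    rw [hq, div_mul_div_comm, mul_comm g2]
  have hq_pos : 0 < q κ₁ := by
    rw [hq']
    exact mul_pos (sqrt_sq_add_mul_sub_div_pos hC hx₁) (by positivity)
  have hq_lt : q κ₁ < q κ₂ := by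
    rw [hq', hq']
    exact mul_lt_mul_of_pos_right
      (strictAntiOn_sqrt_sq_add_mul_sub_div hC hx₂ hx₁ hx₁₂) (by positivity)
  have hcoef : 0 < 1 - β * f2 * σ2 / (g2 * σt2) := by
    have h : β * (f2 * σ2) < g2 * σt2 := (lt_div_iff₀ (by positivity)).mp hcond
    rw [sub_pos, div_lt_one (by positivity), mul_assoc]
    exact h
  have hT_pos : 0 < T κ₁ := by
    rw [hT]
    positivity
  have hT_lt : T κ₁ < T κ₂ := by
    rw [hT, hT]
    gcongr
  rw [hRSU, hRSU]
  exact mul_lt_mul_of_pos_left (Real.logb_lt_logb one_lt_two hT_pos hT_lt) one_half_pos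
end

section
/- Let σ² > 0, σ̃² > 0, |g|² > 0, |f|² > 0, β ∈ ℝ, C > 0, and for κ ∈ [0,1) define q(κ) := (√(β² + (1−κ²)·C) − β)·σ²/(|g|²·(1−κ²)) and T(κ) := (2·q(κ)·|f|²/σ̃²)·(1 − β·|f|²·σ²/(|g|²·σ̃²)) + (|f|⁴·σ⁴/(|g|⁴·σ̃⁴))·C + 1. Then the following are equivalent: (i) T(κ) > T(0) for every κ ∈ (0,1); (ii) there exists κ ∈ (0,1) with T(κ) > T(0); (iii) |g|²·σ̃²/(|f|²·σ²) > β. In other words, improper signaling (κ > 0) improves the secondary user's achievable rate if and only if the ratio |g|²·σ̃²/(|f|²·σ²) exceeds β. -/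
theorem sqrt_sub_div_eq {β C x : ℝ} (hC : 0 < C) (hx : 0 < x) :
    0 < √(β ^ 2 + x * C) + β ∧ (√(β ^ 2 + x * C) - β) / x = C / (√(β ^ 2 + x * C) + β) := by
  have hxC : 0 < x * C := mul_pos hx hC
  have hpos : 0 < √(β ^ 2 + x * C) + β := by
    have : -β < √(β ^ 2 + x * C) := Real.lt_sqrt_of_sq_lt (by linarith [neg_sq β])
    linarith
  have hsq : √(β ^ 2 + x * C) ^ 2 = β ^ 2 + x * C := Real.sq_sqrt (by positivity)
  refine ⟨hpos, ?_⟩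
  rw [div_eq_div_iff hx.ne' hpos.ne']
  linear_combination hsq

/-- The map `x ↦ (√(β² + x C) - β) / x` is strictly decreasing on the positive reals. -/
theorem sqrt_sub_div_strictAntiOn {β C : ℝ} (hC : 0 < C) :
    StrictAntiOn (fun x : ℝ => (√(β ^ 2 + x * C) - β) / x) (Set.Ioi 0) := by
  intro x hx y hy hxy
  obtain ⟨hx0, hxe⟩ := sqrt_sub_div_eq (β := β) hC hx
  obtain ⟨hy0, hye⟩ := sqrt_sub_div_eq (β := β) hC hy
  have hlt : √(β ^ 2 + x * C) < √(β ^ 2 + y * C) :=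
    Real.sqrt_lt_sqrt (by have := mul_pos (Set.mem_Ioi.mp hx) hC; positivity)
      (by linarith [mul_lt_mul_of_pos_right hxy hC])
  simp only [hxe, hye]
  exact div_lt_div_of_pos_left hC hx0 (by linarith)

/-- Theorem 1 (necessary and sufficient condition). The following
are equivalent: (i) `T(κ) > T(0)` for every `κ ∈ (0,1)`; (ii) there exists
`κ ∈ (0,1)` with `T(κ) > T(0)`; (iii) `|g|²σ̃²/(|f|²σ²) > β`. That is, improper
signaling improves the secondary user's rate iff the channel-gain ratio exceeds
`β`. Here `g2 = |g|²`, `f2 = |f|²`, `σ2 = σ²`, `σt2 = σ̃²`. -/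
theorem improper_beneficial_iff
    (σ2 σt2 g2 f2 β C : ℝ)
    (hσ : 0 < σ2) (hσt : 0 < σt2) (hg : 0 < g2) (hf : 0 < f2) (hC : 0 < C)
    (q T : ℝ → ℝ)
    (hq : ∀ κ : ℝ, q κ = (Real.sqrt (β ^ 2 + (1 - κ ^ 2) * C) - β) * σ2
        / (g2 * (1 - κ ^ 2)))
    (hT : ∀ κ : ℝ, T κ = (2 * q κ * f2 / σt2) * (1 - β * f2 * σ2 / (g2 * σt2))
        + (f2 ^ 2 * σ2 ^ 2 / (g2 ^ 2 * σt2 ^ 2)) * C + 1) :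
    ((∀ κ : ℝ, 0 < κ → κ < 1 → T κ > T 0) ↔ g2 * σt2 / (f2 * σ2) > β) ∧
      ((∃ κ : ℝ, 0 < κ ∧ κ < 1 ∧ T κ > T 0) ↔ g2 * σt2 / (f2 * σ2) > β) := by
  have key : ∀ κ : ℝ, 0 < κ → κ < 1 → (T κ > T 0 ↔ g2 * σt2 / (f2 * σ2) > β) := by
    intro κ h0 h1
    have hx1 : 1 - κ ^ 2 < 1 - (0 : ℝ) ^ 2 := by nlinarith
    have hx0 : 0 < 1 - κ ^ 2 := by nlinarith
    have hanti := sqrt_sub_div_strictAntiOn (β := β) hC (Set.mem_Ioi.mpr hx0)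
      (Set.mem_Ioi.mpr (hx0.trans hx1)) hx1
    have hqlt : q 0 < q κ := by
      have := mul_lt_mul_of_pos_right hanti (div_pos hσ hg)
      simpa only [hq, div_mul_div_comm, mul_comm g2] using this
    have hdiff : T κ - T 0 = (q κ - q 0) * (2 * f2 / σt2 * (f2 * σ2 / (g2 * σt2))) *
        (g2 * σt2 / (f2 * σ2) - β) := by
      rw [hT κ, hT 0]
      field_simp
      ring
    have hK : 0 < (q κ - q 0) * (2 * f2 / σt2 * (f2 * σ2 / (g2 * σt2))) :=
      mul_pos (sub_pos.mpr hqlt) (by positivity)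
    rw [gt_iff_lt, ← sub_pos, hdiff, mul_pos_iff_of_pos_left hK, sub_pos]
  refine ⟨⟨fun h => ?_, fun h κ h0 h1 => (key κ h0 h1).mpr h⟩,
    ⟨fun ⟨κ, h0, h1, h⟩ => (key κ h0 h1).mp h, fun h => ?_⟩⟩
  · exact (key (1 / 2) (by norm_num) (by norm_num)).mp (h _ (by norm_num) (by norm_num))
  · exact ⟨1 / 2, by norm_num, by norm_num, (key _ (by norm_num) (by norm_num)).mpr h⟩
end

section
/- Let σ² > 0, |g|² > 0, Q > 0, β ∈ ℝ, C > 0, and set x := σ²/(Q·|g|²). Suppose 0 < C·x² − 2βx ≤ 1, and define κ* := √(1 − x·(C·x − 2β)) ∈ [0,1). Then the allowed-power function q(κ) := (√(β² + (1−κ²)·C) − β)·σ²/(|g|²·(1−κ²)) satisfies q(κ*) = Q. That is, the circularity coefficient κ* given in Theorem 1 makes the secondary user's allowed power exactly equal to its power budget Q. -/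
/-- Second case of the optimal circularity coefficient in
Theorem 1. With `x = σ²/(Q|g|²)` and `0 < C·x² − 2βx ≤ 1`, the coefficient
`κ* = √(1 − x(Cx − 2β))` lies in `[0,1)` and makes the allowed power exactly
equal to the power budget: `q(κ*) = Q`. Here `g2 = |g|²`, `σ2 = σ²`. -/
theorem optimal_kappa_full_power
    (σ2 g2 Q β C : ℝ)
    (hσ : 0 < σ2) (hg : 0 < g2) (hQ : 0 < Q) (hC : 0 < C)
    (x : ℝ) (hx : x = σ2 / (Q * g2))
    (hlo : 0 < C * x ^ 2 - 2 * β * x) (hhi : C * x ^ 2 - 2 * β * x ≤ 1)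
    (κs : ℝ) (hκs : κs = Real.sqrt (1 - x * (C * x - 2 * β)))
    (q : ℝ → ℝ)
    (hq : ∀ κ : ℝ, q κ = (Real.sqrt (β ^ 2 + (1 - κ ^ 2) * C) - β) * σ2
        / (g2 * (1 - κ ^ 2))) :
    0 ≤ κs ∧ κs < 1 ∧ q κs = Q := by
  have hx_pos : 0 < x := by rw [hx]; positivity
  have hgap : 0 < C * x - 2 * β := pos_of_mul_pos_right (by linarith) hx_pos.le
  have hCx : 0 < C * x := mul_pos hC hx_pos
  have hκ : 1 - κs ^ 2 = x * (C * x - 2 * β) := by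
    rw [hκs, Real.sq_sqrt (by linarith)]
    ring
  have hκ_nonneg : 0 ≤ κs := hκs ▸ Real.sqrt_nonneg _
  refine ⟨hκ_nonneg, ?_, ?_⟩
  · nlinarith [mul_pos hx_pos hgap]
  · have hsqrt : Real.sqrt (β ^ 2 + x * (C * x - 2 * β) * C) = C * x - β := by
      rw [show β ^ 2 + x * (C * x - 2 * β) * C = (C * x - β) ^ 2 by ring]
      exact Real.sqrt_sq (by linarith)
    have hσx : σ2 = x * (Q * g2) := by
      rw [hx]
      field_simp
    rw [hq, hκ, hsqrt, hσx, div_eq_iff (by positivity)]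
    ring
end

section
/- Let R₀ > 0 and α ∈ (0, 1/2]. Define γ(a) := 2^{a·R₀} − 1 and β := 1 − γ(1)/γ(2α). Then β ≤ 0. Consequently, for any σ² > 0, σ̃² > 0, |g|² > 0, |f|² > 0, the condition |g|²·σ̃²/(|f|²·σ²) > β of Theorem 1 holds, so improper signaling improves the secondary user's rate regardless of the channel gains. -/
/-- If the loading factor satisfies `α ≤ 1/2`, then
`β = 1 − γ(1)/γ(2α) ≤ 0`, and consequently the condition
`|g|²σ̃²/(|f|²σ²) > β` of Theorem 1 holds for all channel gains, so improper
signaling always improves the secondary user's rate. -/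
theorem beta_nonpos_of_half_load
    (R0 α : ℝ) (hR0 : 0 < R0) (hα0 : 0 < α) (hα1 : α ≤ 1 / 2)
    (γ : ℝ → ℝ) (hγ : ∀ a : ℝ, γ a = (2 : ℝ) ^ (a * R0) - 1)
    (β : ℝ) (hβ : β = 1 - γ 1 / γ (2 * α)) :
    β ≤ 0 ∧
      ∀ σ2 σt2 g2 f2 : ℝ, 0 < σ2 → 0 < σt2 → 0 < g2 → 0 < f2 →
        g2 * σt2 / (f2 * σ2) > β := by
  have hden : 0 < γ (2 * α) := by
    rw [hγ, sub_pos]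
    exact Real.one_lt_rpow one_lt_two (by positivity)
  have hmono : γ (2 * α) ≤ γ 1 := by
    rw [hγ, hγ]
    gcongr
    · exact one_le_two
    · linarith
  have hβ_nonpos : β ≤ 0 := by
    rw [hβ, sub_nonpos]
    exact (one_le_div hden).2 hmono
  refine ⟨hβ_nonpos, fun σ2 σt2 g2 f2 hσ2 hσt2 hg2 hf2 => ?_⟩
  exact hβ_nonpos.trans_lt (by positivity)
end
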